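/- arXiv:math/0504299 — 4 statements merged into one kernel-verified Lean document; each statement's English description precedes it below -/
import Mathlib

section
/- Let n ∈ ℕ and let F : Δ_n(OXYZ) → ℝ be a polarized function on the tetrahedral grid Δ_n(OXYZ). If the restriction of F to the ground (the face z = 0) and the restriction of F to the front wall (the face y = 0) are discrete concave, then F is polarized discrete concave on Δ_n(OXYZ), i.e. F is polarized and every rhombus inequality whose four points lie in Δ_n(OXYZ) holds. -/
/-- Points of the three-dimensional lattice. -/
abbrev V3 : Type := ℤ × ℤ × ℤ

def e1 : V3 := (1, 0, 0)
def e2 : V3 := (0, 1, 0)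
def e3 : V3 := (0, 0, 1)

/-- The unimodular set `D = {e₁, e₂, e₃, e₁−e₂, e₁−e₃, e₂−e₃}`. -/
def Dset : Set V3 := {e1, e2, e3, e1 - e2, e1 - e3, e2 - e3}

/-- The set `±D = D ∪ (−D)`. -/
def pmD : Set V3 := {v | v ∈ Dset ∨ -v ∈ Dset}

/-- `F` is polarized on `S`: for every primitive octahedron contained in `S`, the sum of the
values at the ends of the main diagonal (direction `(−1,1,1)`) equals the maximum of the sums
at the ends of the two other diagonals. -/
def IsPolarizedOn (S : Set V3) (F : V3 → ℝ) : Prop :=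
  ∀ p : V3, p ∈ S → p + (-1, 1, 1) ∈ S → p + (0, 0, 1) ∈ S → p + (-1, 1, 0) ∈ S →
    p + (0, 1, 0) ∈ S → p + (-1, 0, 1) ∈ S →
    F p + F (p + (-1, 1, 1)) =
      max (F (p + (0, 0, 1)) + F (p + (-1, 1, 0))) (F (p + (0, 1, 0)) + F (p + (-1, 0, 1)))

/-- `(q, q+a, q+b, q+a+b)` is a primitive rhombus: `a, b ∈ ±D`, `a ≠ ±b`, and one of the
diagonal directions `a+b`, `a−b` lies in `±D` (that diagonal is the short one). -/
def IsPrimRhombus (a b : V3) : Prop :=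
  a ∈ pmD ∧ b ∈ pmD ∧ a ≠ b ∧ a ≠ -b ∧ (a + b ∈ pmD ∨ a - b ∈ pmD)

/-- The rhombus inequalities associated to the primitive rhombus `(q, q+a, q+b, q+a+b)`:
the sum at the short diagonal is at least the sum at the long diagonal. -/
def RhombusIneq (F : V3 → ℝ) (q a b : V3) : Prop :=
  (a + b ∈ pmD → F q + F (q + a + b) ≥ F (q + a) + F (q + b)) ∧
  (a - b ∈ pmD → F (q + a) + F (q + b) ≥ F q + F (q + a + b))

/-- All rhombus inequalities for primitive rhombi whose four points lie in `S` hold. -/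
def DiscreteConcaveOn (S : Set V3) (F : V3 → ℝ) : Prop :=
  ∀ q a b : V3, IsPrimRhombus a b → q ∈ S → q + a ∈ S → q + b ∈ S → q + a + b ∈ S →
    RhombusIneq F q a b

/-- `F` is polarized discrete concave on `S`. -/
def PDCOn (S : Set V3) (F : V3 → ℝ) : Prop :=
  IsPolarizedOn S F ∧ DiscreteConcaveOn S F

/-- The tetrahedral grid `Δ_n(OXYZ)`. -/
def Tet (n : ℕ) : Set V3 :=
  {v | 0 ≤ v.1 ∧ 0 ≤ v.2.1 ∧ 0 ≤ v.2.2 ∧ v.1 + v.2.1 + v.2.2 ≤ (n : ℤ)}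

/-- The ground face `z = 0` of `Δ_n(OXYZ)`. -/
def ground (n : ℕ) : Set V3 := {v | v ∈ Tet n ∧ v.2.2 = 0}

/-- The front wall `y = 0` of `Δ_n(OXYZ)`. -/
def frontWall (n : ℕ) : Set V3 := {v | v ∈ Tet n ∧ v.2.1 = 0}

/-- The shadow wall `x = 0` of `Δ_n(OXYZ)`. -/
def shadowWall (n : ℕ) : Set V3 := {v | v ∈ Tet n ∧ v.1 = 0}

/-- The slope wall `x + y + z = n` of `Δ_n(OXYZ)`. -/
def slopeWall (n : ℕ) : Set V3 := {v | v ∈ Tet n ∧ v.1 + v.2.1 + v.2.2 = (n : ℤ)}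

/-- The family `R(d)` of rhombus inequalities on `S` for rhombi whose short diagonal has
direction `±d`. -/
def FaceR (S : Set V3) (F : V3 → ℝ) (d : V3) : Prop :=
  ∀ q a b : V3, IsPrimRhombus a b → q ∈ S → q + a ∈ S → q + b ∈ S → q + a + b ∈ S →
    ((a + b = d ∨ a + b = -d) → F q + F (q + a + b) ≥ F (q + a) + F (q + b)) ∧
    ((a - b = d ∨ a - b = -d) → F (q + a) + F (q + b) ≥ F q + F (q + a + b))

/-- The octahedron recurrence, in homogeneous coordinates: `f w x y z` is used for
`w + x + y + z = N + 2`, and the octahedron of base `(w, x, y, z)`, with `w + x + y + z = N`,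
has its main diagonal joining the base shifted by `w, x` to the base shifted by `y, z`. -/
def OctRec (N : ℕ) (f : ℕ → ℕ → ℕ → ℕ → ℝ) : Prop :=
  ∀ w x y z, w + x + y + z = N →
    f (w + 1) (x + 1) y z + f w x (y + 1) (z + 1) =
      max (f w (x + 1) y (z + 1) + f (w + 1) x (y + 1) z)
        (f w (x + 1) (y + 1) z + f (w + 1) x y (z + 1))

namespace OctRec

variable {N : ℕ} {f : ℕ → ℕ → ℕ → ℕ → ℝ}

theorem swap_wx (hf : OctRec N f) : OctRec N fun w x y z => f x w y z := by
  intro w x y z h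
  have := hf x w y z (by omega)
  rw [max_comm, add_comm (f x (w + 1) _ _), add_comm (f x (w + 1) _ _)] at this
  exact this

theorem swap_yz (hf : OctRec N f) : OctRec N fun w x y z => f w x z y := by
  intro w x y z h
  rw [max_comm]
  exact hf w x z y (by omega)

theorem le_left (hf : OctRec N f) {w x y z : ℕ} (h : w + x + y + z = N) :
    f w (x + 1) y (z + 1) + f (w + 1) x (y + 1) z ≤
      f (w + 1) (x + 1) y z + f w x (y + 1) (z + 1) :=
  hf w x y z h ▸ le_max_left _ _

theorem le_right (hf : OctRec N f) {w x y z : ℕ} (h : w + x + y + z = N) :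
    f w (x + 1) (y + 1) z + f (w + 1) x y (z + 1) ≤
      f (w + 1) (x + 1) y z + f w x (y + 1) (z + 1) :=
  hf w x y z h ▸ le_max_right _ _

theorem eq_or_eq (hf : OctRec N f) {w x y z : ℕ} (h : w + x + y + z = N) :
    f (w + 1) (x + 1) y z + f w x (y + 1) (z + 1) =
        f w (x + 1) y (z + 1) + f (w + 1) x (y + 1) z ∨
      f (w + 1) (x + 1) y z + f w x (y + 1) (z + 1) =
        f w (x + 1) (y + 1) z + f (w + 1) x y (z + 1) := by
  rw [hf w x y z h]
  exact max_choice _ _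

/-- The rhombus inequalities at the vertex `y` with short diagonal in direction `w - x`
propagate from the face `z = 0`. -/
theorem rhombus_y (hf : OctRec N f)
    (h0 : ∀ w x y, w + x + y = N →
      f w x (y + 2) 0 + f (w + 1) (x + 1) y 0 ≤ f w (x + 1) (y + 1) 0 + f (w + 1) x (y + 1) 0)
    (z : ℕ) : ∀ w x y, w + x + y + z = N →
      f w x (y + 2) z + f (w + 1) (x + 1) y z ≤
        f w (x + 1) (y + 1) z + f (w + 1) x (y + 1) z := by
  induction z with
  | zero => exact fun w x y h => h0 w x y h
  | succ z ih =>
    intro w x y h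
    have h₁ := ih (w + 1) x y (by omega)
    have h₂ := ih w (x + 1) y (by omega)
    have h₃ := hf.le_left (w := w + 1) (x := x) (y := y) (z := z) (by omega)
    have h₄ := hf.le_right (w := w + 1) (x := x) (y := y) (z := z) (by omega)
    have h₅ := hf.le_left (w := w) (x := x + 1) (y := y) (z := z) (by omega)
    have h₆ := hf.le_right (w := w) (x := x + 1) (y := y) (z := z) (by omega)
    rcases hf.eq_or_eq (w := w) (x := x) (y := y + 1) (z := z) (by omega) with e | e <;>
      linarith

/-- The rhombus inequalities at the vertex `x` with short diagonals in directions `y - w` and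
`z - w` propagate from the faces `z = 0` and `y = 0` respectively. -/
theorem rhombus_x (hf : OctRec N f)
    (hz : ∀ w x y, w + x + y = N →
      f w (x + 2) y 0 + f (w + 1) x (y + 1) 0 ≤ f w (x + 1) (y + 1) 0 + f (w + 1) (x + 1) y 0)
    (hy : ∀ w x z, w + x + z = N →
      f w (x + 2) 0 z + f (w + 1) x 0 (z + 1) ≤ f w (x + 1) 0 (z + 1) + f (w + 1) (x + 1) 0 z)
    (k : ℕ) : ∀ w x y z, w + x + y + z = N → y + z = k →
      f w (x + 2) y z + f (w + 1) x (y + 1) z ≤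
          f w (x + 1) (y + 1) z + f (w + 1) (x + 1) y z ∧
        f w (x + 2) y z + f (w + 1) x y (z + 1) ≤
          f w (x + 1) y (z + 1) + f (w + 1) (x + 1) y z := by
  induction k with
  | zero =>
    intro w x y z h hk
    obtain ⟨rfl, rfl⟩ : y = 0 ∧ z = 0 := by omega
    exact ⟨hz w x 0 h, hy w x 0 h⟩
  | succ k ih =>
    have yz : ∀ w x y z, w + x + y + z = N → y + z = k →
        f w (x + 2) y z + f w x (y + 1) (z + 1) ≤
          f w (x + 1) (y + 1) z + f w (x + 1) y (z + 1) := by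
      intro w x y z h hk
      have := ih w x y z h hk
      rcases hf.eq_or_eq h with e | e <;> linarith
    intro w x y z h hk
    constructor
    · cases z with
      | zero => exact hz w x y h
      | succ z =>
        have h₁ := yz (w + 1) x y z (by omega) (by omega)
        have h₂ := hf.le_left (w := w) (x := x + 1) (y := y) (z := z) (by omega)
        linarith
    · cases y with
      | zero => exact hy w x z (by omega)
      | succ y =>
        have h₁ := yz (w + 1) x y z (by omega) (by omega)
        have h₂ := hf.le_right (w := w) (x := x + 1) (y := y) (z := z) (by omega)
        linarith

end OctRec

theorem DiscreteConcaveOn.acute {S : Set V3} {F : V3 → ℝ} (hF : DiscreteConcaveOn S F)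
    (q a b : V3) (ha : a ∈ pmD) (hb : b ∈ pmD) (hab : a - b ∈ pmD) (hne : a ≠ b) (hne' : a ≠ -b)
    (h₀ : q ∈ S) (h₁ : q + a ∈ S) (h₂ : q + b ∈ S) (h₃ : q + a + b ∈ S) :
    F q + F (q + a + b) ≤ F (q + a) + F (q + b) :=
  (hF q a b ⟨ha, hb, hne, hne', Or.inr hab⟩ h₀ h₁ h₂ h₃).2 hab

theorem neg_mem_pmD {a : V3} (ha : a ∈ pmD) : -a ∈ pmD := by
  rcases ha with h | h
  · exact Or.inr (by rwa [neg_neg])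
  · exact Or.inl h

theorem mem_pmD_iff (a b c : ℤ) : ((a, b, c) : V3) ∈ pmD ↔
    a = 1 ∧ b = 0 ∧ c = 0 ∨ a = 0 ∧ b = 1 ∧ c = 0 ∨ a = 0 ∧ b = 0 ∧ c = 1 ∨
    a = 1 ∧ b = -1 ∧ c = 0 ∨ a = 1 ∧ b = 0 ∧ c = -1 ∨ a = 0 ∧ b = 1 ∧ c = -1 ∨
    a = -1 ∧ b = 0 ∧ c = 0 ∨ a = 0 ∧ b = -1 ∧ c = 0 ∨ a = 0 ∧ b = 0 ∧ c = -1 ∨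
    a = -1 ∧ b = 1 ∧ c = 0 ∨ a = -1 ∧ b = 0 ∧ c = 1 ∨ a = 0 ∧ b = -1 ∧ c = 1 := by
  simp only [pmD, Dset, e1, e2, e3, Set.mem_ofPred_eq, Set.mem_insert_iff, Set.mem_singleton_iff,
    Prod.mk_sub_mk, Prod.neg_mk, Prod.mk.injEq, neg_eq_iff_eq_neg]
  norm_num [or_assoc]

/-- The twelve rhombus inequalities of base `(x, y, z)`. In homogeneous coordinates, they compare
the points obtained from the base by raising two coordinates. -/
theorem tet_rhombi {n : ℕ} {F : V3 → ℝ} (hpol : IsPolarizedOn (Tet n) F)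
    (hground : DiscreteConcaveOn (ground n) F) (hfront : DiscreteConcaveOn (frontWall n) F)
    (x y z : ℤ) (hx : 0 ≤ x) (hy : 0 ≤ y) (hz : 0 ≤ z) (hn : x + y + z + 2 ≤ n) :
    (F (x, y, z) + F (x + 1, y + 1, z) ≤ F (x + 1, y, z) + F (x, y + 1, z) ∧
      F (x, y, z) + F (x + 1, y, z + 1) ≤ F (x + 1, y, z) + F (x, y, z + 1) ∧
      F (x, y, z) + F (x, y + 1, z + 1) ≤ F (x, y + 1, z) + F (x, y, z + 1)) ∧
    (F (x + 2, y, z) + F (x, y + 1, z) ≤ F (x + 1, y, z) + F (x + 1, y + 1, z) ∧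
      F (x + 2, y, z) + F (x, y, z + 1) ≤ F (x + 1, y, z) + F (x + 1, y, z + 1) ∧
      F (x + 2, y, z) + F (x, y + 1, z + 1) ≤ F (x + 1, y + 1, z) + F (x + 1, y, z + 1)) ∧
    (F (x, y + 2, z) + F (x + 1, y, z) ≤ F (x, y + 1, z) + F (x + 1, y + 1, z) ∧
      F (x, y + 2, z) + F (x, y, z + 1) ≤ F (x, y + 1, z) + F (x, y + 1, z + 1) ∧
      F (x, y + 2, z) + F (x + 1, y, z + 1) ≤ F (x + 1, y + 1, z) + F (x, y + 1, z + 1)) ∧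
    (F (x, y, z + 2) + F (x + 1, y, z) ≤ F (x, y, z + 1) + F (x + 1, y, z + 1) ∧
      F (x, y, z + 2) + F (x, y + 1, z) ≤ F (x, y, z + 1) + F (x, y + 1, z + 1) ∧
      F (x, y, z + 2) + F (x + 1, y + 1, z) ≤ F (x + 1, y, z + 1) + F (x, y + 1, z + 1)) := by
  lift x to ℕ using hx
  lift y to ℕ using hy
  lift z to ℕ using hz
  obtain ⟨w, rfl⟩ : ∃ w, n = w + x + y + z + 2 := ⟨n - (x + y + z + 2), by omega⟩
  clear hn
  obtain ⟨N, hN⟩ : ∃ N, w + x + y + z = N := ⟨_, rfl⟩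
  rw [hN] at hpol hground hfront
  let f : ℕ → ℕ → ℕ → ℕ → ℝ := fun _ x y z => F (x, y, z)
  have hf : OctRec N f := by
    intro w x y z h
    have := hpol (x + 1, y, z)
    simp only [Tet, Set.mem_ofPred_eq, Prod.mk_add_mk, add_zero, add_neg_cancel_right] at this
    simp only [f]
    push_cast
    apply this <;> omega
  have ground_acute : ∀ (x y a₁ a₂ b₁ b₂ : ℤ), (a₁, a₂, 0) ∈ pmD → (b₁, b₂, 0) ∈ pmD →
      (a₁ - b₁, a₂ - b₂, 0) ∈ pmD → (x, y, 0) ∈ Tet (N + 2) →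
      (x + a₁, y + a₂, 0) ∈ Tet (N + 2) → (x + b₁, y + b₂, 0) ∈ Tet (N + 2) →
      (x + a₁ + b₁, y + a₂ + b₂, 0) ∈ Tet (N + 2) →
      F (x, y, 0) + F (x + a₁ + b₁, y + a₂ + b₂, 0) ≤
        F (x + a₁, y + a₂, 0) + F (x + b₁, y + b₂, 0) := by
    intro x y a₁ a₂ b₁ b₂ ha hb hab h₀ h₁ h₂ h₃
    have := hground.acute (x, y, 0) (a₁, a₂, 0) (b₁, b₂, 0) ha hb (by simpa using hab)
    simp only [ground, Set.mem_ofPred_eq, Prod.mk_add_mk, add_zero, Prod.neg_mk, ne_eq,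
      Prod.mk.injEq, mem_pmD_iff, and_true] at this ha hb hab
    apply this <;> first | assumption | omega
  have front_acute : ∀ (x z a₁ a₃ b₁ b₃ : ℤ), (a₁, 0, a₃) ∈ pmD → (b₁, 0, b₃) ∈ pmD →
      (a₁ - b₁, 0, a₃ - b₃) ∈ pmD → (x, 0, z) ∈ Tet (N + 2) →
      (x + a₁, 0, z + a₃) ∈ Tet (N + 2) → (x + b₁, 0, z + b₃) ∈ Tet (N + 2) →
      (x + a₁ + b₁, 0, z + a₃ + b₃) ∈ Tet (N + 2) →
      F (x, 0, z) + F (x + a₁ + b₁, 0, z + a₃ + b₃) ≤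
        F (x + a₁, 0, z + a₃) + F (x + b₁, 0, z + b₃) := by
    intro x z a₁ a₃ b₁ b₃ ha hb hab h₀ h₁ h₂ h₃
    have := hfront.acute (x, 0, z) (a₁, 0, a₃) (b₁, 0, b₃) ha hb (by simpa using hab)
    simp only [frontWall, Set.mem_ofPred_eq, Prod.mk_add_mk, add_zero, Prod.neg_mk, ne_eq,
      Prod.mk.injEq, mem_pmD_iff, and_true, true_and] at this ha hb hab
    apply this <;> first | assumption | omega
  simp only [mem_pmD_iff, Tet, Set.mem_ofPred_eq] at ground_acute front_acute
  have hw := hf.swap_wx.rhombus_x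
    (fun w x y h => by
      have := ground_acute w y 1 0 0 1 (by decide) (by decide) (by decide) (by omega) (by omega)
        (by omega) (by omega)
      simp only [f]; push_cast; simp only [add_zero] at this; linarith)
    (fun w x z h => by
      have := front_acute w z 1 0 0 1 (by decide) (by decide) (by decide) (by omega) (by omega)
        (by omega) (by omega)
      simp only [f]; push_cast; simp only [add_zero] at this; linarith)
    (y + z) x w y z (by omega) rfl
  have hx := hf.rhombus_x
    (fun w x y h => by
      have := ground_acute (x + 2) y (-1) 0 (-1) 1 (by decide) (by decide) (by decide) (by omega)
        (by omega) (by omega) (by omega)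
      simp only [f]; push_cast; ring_nf at this ⊢; linarith)
    (fun w x z h => by
      have := front_acute (x + 2) z (-1) 0 (-1) 1 (by decide) (by decide) (by decide) (by omega)
        (by omega) (by omega) (by omega)
      simp only [f]; push_cast; ring_nf at this ⊢; linarith)
    (y + z) w x y z hN rfl
  have hy := hf.rhombus_y
    (fun w x y h => by
      have := ground_acute x (y + 2) 0 (-1) 1 (-1) (by decide) (by decide) (by decide) (by omega)
        (by omega) (by omega) (by omega)
      simp only [f]; push_cast; ring_nf at this ⊢; linarith)
    z w x y hN
  have hz := hf.swap_yz.rhombus_y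
    (fun w x z h => by
      have := front_acute x (z + 2) 0 (-1) 1 (-1) (by decide) (by decide) (by decide) (by omega)
        (by omega) (by omega) (by omega)
      simp only [f]; push_cast; ring_nf at this ⊢; linarith)
    y w x z (by omega)
  have l := hf.le_left hN
  have r := hf.le_right hN
  have e := hf.eq_or_eq hN
  simp only [f] at hw hx hy hz l r e
  push_cast at hw hx hy hz l r e
  refine ⟨⟨?_, ?_, ?_⟩, ⟨?_, ?_, ?_⟩, ⟨?_, ?_, ?_⟩, ⟨?_, ?_, ?_⟩⟩ <;>
    first | linarith | rcases e with e | e <;> linarith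

set_option maxHeartbeats 1000000 in
/-- A rhombus inequality follows from those of the base given by the coordinatewise minimum of
the four points. -/
theorem tet_acute {n : ℕ} {F : V3 → ℝ} (hpol : IsPolarizedOn (Tet n) F)
    (hground : DiscreteConcaveOn (ground n) F) (hfront : DiscreteConcaveOn (frontWall n) F)
    (q a b : V3) (ha : a ∈ pmD) (hb : b ∈ pmD) (hab : a - b ∈ pmD)
    (h₀ : q ∈ Tet n) (h₁ : q + a ∈ Tet n) (h₂ : q + b ∈ Tet n) (h₃ : q + a + b ∈ Tet n) :
    F q + F (q + a + b) ≤ F (q + a) + F (q + b) := by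
  have H := tet_rhombi hpol hground hfront
  obtain ⟨x, y, z⟩ := q
  obtain ⟨a₁, a₂, a₃⟩ := a
  obtain ⟨b₁, b₂, b₃⟩ := b
  replace H := H (x + min (min 0 a₁) (min b₁ (a₁ + b₁))) (y + min (min 0 a₂) (min b₂ (a₂ + b₂)))
    (z + min (min 0 a₃) (min b₃ (a₃ + b₃)))
  simp only [Tet, Set.mem_ofPred_eq, Prod.mk_add_mk, Prod.mk_sub_mk, mem_pmD_iff]
    at ha hb hab h₀ h₁ h₂ h₃ ⊢
  rcases ha with h | h | h | h | h | h | h | h | h | h | h | h <;>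
    obtain ⟨rfl, rfl, rfl⟩ := h <;>
    rcases hb with h | h | h | h | h | h | h | h | h | h | h | h <;>
    obtain ⟨rfl, rfl, rfl⟩ := h <;>
    first
    | exact absurd hab (by decide)
    | (replace H := H (by omega) (by omega) (by omega) (by omega)
       norm_num [add_assoc] at H ⊢
       linarith)

/-- if a polarized function on the tetrahedral grid `Δ_n(OXYZ)` has discrete
concave restrictions to the ground and the front wall, then it is polarized discrete concave. -/
theorem tet_polarized_discrete_concave (n : ℕ) (F : V3 → ℝ)
    (hpol : IsPolarizedOn (Tet n) F)
    (hground : DiscreteConcaveOn (ground n) F)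
    (hfront : DiscreteConcaveOn (frontWall n) F) :
    PDCOn (Tet n) F := by
  refine ⟨hpol, fun q a b ⟨ha, hb, _⟩ h₀ h₁ h₂ h₃ => ⟨fun hab => ?_, fun hab => ?_⟩⟩
  · have := tet_acute hpol hground hfront (q + a) (-a) b (neg_mem_pmD ha) hb
      (by simpa [sub_eq_add_neg, add_comm] using neg_mem_pmD hab) h₁ (by simpa using h₀) h₃
      (by simpa using h₂)
    simp only [add_neg_cancel_right] at this
    linarith
  · exact tet_acute hpol hground hfront q a b ha hb hab h₀ h₁ h₂ h₃
end

section
/- Let n ∈ ℕ and let F : Δ_n(OXYZ) → ℝ be a polarized function on the tetrahedral grid Δ_n(OXYZ). Assume the restriction of F to the ground (face z = 0) is HS-concave with horizontal direction e₁, i.e. strip-concave along e₁ (the families R(e₂) and R(e₁−e₂) hold on the ground), and the restriction of F to the front wall (face y = 0) is VS-concave with vertical direction e₃, i.e. strip-concave along e₃ (R(e₁) and R(e₁−e₃) hold on the front wall). Then the restriction of F to the shadow wall (face x = 0) is VS-concave with vertical direction e₃, i.e. strip-concave along e₃ (R(e₂) and R(e₂−e₃) hold on the shadow wall). -/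
/-- Interlacing of the difference sequences of `g` and `h` on the window `{0, …, m}`: the strip
between two neighbouring vertical lines satisfies both families of rhombus inequalities. -/
def Interlaces (m : ℕ) (g h : ℕ → ℝ) : Prop :=
  (∀ z, z + 2 ≤ m → g z + h (z + 1) ≤ g (z + 1) + h z) ∧
  (∀ z, z + 2 ≤ m → h z + g (z + 2) ≤ g (z + 1) + h (z + 1))

/-- The octahedron rule in a prism over a unit square transports interlacing from the sides
`g h` and `h l` to the opposite sides `g k` and `k l`. -/
theorem Interlaces.transport {m : ℕ} {g h k l : ℕ → ℝ}
    (hoct : ∀ z, z + 2 ≤ m →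
      h z + k (z + 1) = max (h (z + 1) + k z) (l z + g (z + 1)))
    (hbase : 2 ≤ m → g 0 + l 0 ≤ h 0 + k 0)
    (hgh : Interlaces m g h) (hhl : Interlaces (m - 1) h l) :
    Interlaces m g k ∧ Interlaces (m - 1) k l := by
  have hleft : ∀ z, z + 2 ≤ m → h (z + 1) + k z ≤ h z + k (z + 1) := fun z hz => by
    rw [hoct z hz]; exact le_max_left _ _
  have hright : ∀ z, z + 2 ≤ m → l z + g (z + 1) ≤ h z + k (z + 1) := fun z hz => by
    rw [hoct z hz]; exact le_max_right _ _
  have hhoriz : ∀ z, z + 2 ≤ m → g z + l z ≤ h z + k z := by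
    intro z hz
    cases z with
    | zero => exact hbase (by omega)
    | succ z =>
      linarith [hright z (by omega), hhl.1 z (by omega)]
  refine ⟨⟨fun z hz => ?_, fun z hz => ?_⟩, ⟨fun z hz => ?_, fun z hz => ?_⟩⟩
  · have h1 := hgh.1 z hz
    have h2 := hhoriz z hz
    rcases max_choice (h (z + 1) + k z) (l z + g (z + 1)) with e | e <;>
      linarith [hoct z hz]
  · linarith [hleft z hz, hgh.2 z hz]
  · linarith [hleft z (by omega), hhl.1 z (by omega)]
  · have h1 := hhl.2 z (by omega)
    have h2 := hright z (by omega)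
    have h3 := hgh.2 z (by omega)
    rcases max_choice (h (z + 1 + 1) + k (z + 1)) (l (z + 1) + g (z + 1 + 1)) with e | e <;>
      linarith [hoct (z + 1) (by omega)]

/-- Interlacing in the direction of the first coordinate on the front wall propagates through the
grid to interlacing in the direction of the second coordinate. -/
theorem interlaces_of_octahedron_rule {n : ℕ} {f : ℕ → ℕ → ℕ → ℝ}
    (hoct : ∀ x y z, x + y + z + 2 ≤ n →
      f (x + 1) y z + f x (y + 1) (z + 1) =
        max (f (x + 1) y (z + 1) + f x (y + 1) z) (f (x + 1) (y + 1) z + f x y (z + 1)))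
    (hground : ∀ x y, x + y + 2 ≤ n →
      f x y 0 + f (x + 1) (y + 1) 0 ≤ f (x + 1) y 0 + f x (y + 1) 0)
    (hfront : ∀ x, Interlaces (n - x) (f x 0) (f (x + 1) 0)) (x y : ℕ) :
    Interlaces (n - (x + y)) (f x y) (f x (y + 1)) := by
  have step : ∀ x y, Interlaces (n - (x + y)) (f x y) (f (x + 1) y) →
      Interlaces (n - (x + 1 + y)) (f (x + 1) y) (f (x + 1) (y + 1)) →
      Interlaces (n - (x + y)) (f x y) (f x (y + 1)) ∧
        Interlaces (n - (x + (y + 1))) (f x (y + 1)) (f (x + 1) (y + 1)) := by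
    intro x y h1 h2
    have e1 : n - (x + 1 + y) = n - (x + y) - 1 := by omega
    have e2 : n - (x + (y + 1)) = n - (x + y) - 1 := by omega
    rw [e1] at h2
    rw [e2]
    exact Interlaces.transport (fun z hz => hoct x y z (by omega))
      (fun h => hground x y (by omega)) h1 h2
  have row : ∀ y, (∀ x, Interlaces (n - (x + y)) (f x y) (f (x + 1) y)) →
      ∀ j x, n ≤ x + j → Interlaces (n - (x + y)) (f x y) (f x (y + 1)) := by
    intro y hy j
    induction j with
    | zero =>
      intro x hx
      exact ⟨fun z hz => by omega, fun z hz => by omega⟩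
    | succ j ih =>
      intro x hx
      exact (step x y (hy x) (ih (x + 1) (by omega))).1
  have all : ∀ y x, Interlaces (n - (x + y)) (f x y) (f (x + 1) y) := by
    intro y
    induction y with
    | zero => exact hfront
    | succ y ih =>
      intro x
      exact (step x y (ih x) (row y ih n (x + 1) (by omega))).2
  exact row y (all y) n x (by omega)

/-- By the symmetries of a rhombus it suffices to treat short diagonals equal to `a - b = d`. -/
theorem FaceR.of_sub_eq {S : Set V3} {F : V3 → ℝ} {d : V3}
    (h : ∀ q a b : V3, a ∈ pmD → b ∈ pmD → a - b = d →
      q ∈ S → q + a ∈ S → q + b ∈ S → q + a + b ∈ S →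
      F q + F (q + a + b) ≤ F (q + a) + F (q + b)) : FaceR S F d := by
  have h' : ∀ q a b : V3, a ∈ pmD → b ∈ pmD → (a - b = d ∨ a - b = -d) →
      q ∈ S → q + a ∈ S → q + b ∈ S → q + a + b ∈ S →
      F q + F (q + a + b) ≤ F (q + a) + F (q + b) := by
    rintro q a b ha hb (hd | hd) h1 h2 h3 h4
    · exact h q a b ha hb hd h1 h2 h3 h4
    · have := h q b a hb ha (by rw [← neg_sub, hd, neg_neg]) h1 h3 h2 (by rwa [add_right_comm])
      rw [add_right_comm q b a] at this
      linarith
  rintro q a b ⟨ha, hb, -⟩ h1 h2 h3 h4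
  refine ⟨fun hd => ?_, fun hd => h' q a b ha hb hd h1 h2 h3 h4⟩
  have e1 : q + a + b + -a = q + b := by abel
  have e2 : q + a + -a = q := by abel
  have := h' (q + a) b (-a) hb (neg_mem_pmD ha) (by rwa [sub_neg_eq_add, add_comm b a])
    h2 h4 (by rwa [e2]) (by rwa [e1])
  rw [e1, e2] at this
  linarith

theorem FaceR.sub_le {S : Set V3} {F : V3 → ℝ} {d : V3} (h : FaceR S F d) {q a b : V3}
    (ha : a ∈ pmD) (hb : b ∈ pmD) (hd : d ∈ pmD) (hne : a ≠ -b) (hab : a - b = d)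
    (h1 : q ∈ S) (h2 : q + a ∈ S) (h3 : q + b ∈ S) (h4 : q + a + b ∈ S) :
    F q + F (q + a + b) ≤ F (q + a) + F (q + b) := by
  have hab' : a ≠ b := by
    rintro rfl
    rw [sub_self] at hab
    subst hab
    simp [pmD, Dset, e1, e2, e3, Prod.ext_iff] at hd
  exact (h q a b ⟨ha, hb, hab', hne, Or.inr (hab ▸ hd)⟩ h1 h2 h3 h4).2 (Or.inl hab)

/-- if a polarized function on `Δ_n(OXYZ)` is HS-concave on the ground
(strip-concave along `e₁`: `R(e₂)` and `R(e₁−e₂)` hold) and VS-concave on the front wall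
(strip-concave along `e₃`: `R(e₁)` and `R(e₁−e₃)` hold), then it is VS-concave on the shadow
wall (strip-concave along `e₃`: `R(e₂)` and `R(e₂−e₃)` hold). -/
theorem tet_vs_concavity_propagates (n : ℕ) (F : V3 → ℝ)
    (hpol : IsPolarizedOn (Tet n) F)
    (hground₁ : FaceR (ground n) F e2)
    (hground₂ : FaceR (ground n) F (e1 - e2))
    (hfront₁ : FaceR (frontWall n) F e1)
    (hfront₂ : FaceR (frontWall n) F (e1 - e3)) :
    FaceR (shadowWall n) F e2 ∧ FaceR (shadowWall n) F (e2 - e3) := by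
  have hint : ∀ y : ℕ, Interlaces (n - y) (fun z => F (0, y, z)) (fun z => F (0, y + 1, z)) := by
    intro y
    have := interlaces_of_octahedron_rule (n := n) (f := fun x y z => F (x, y, z)) ?_ ?_ ?_ 0 y
    · simpa using this
    · intro x y z hz
      have := hpol (x + 1, y, z)
      simp only [Tet, Set.mem_ofPred_eq, Prod.mk_add_mk, add_zero, add_neg_cancel_right] at this
      have := this (by omega) (by omega) (by omega) (by omega) (by omega) (by omega)
      push_cast
      rw [this, add_comm (F (x + 1, y + 1, z))]
    · intro x y hxy
      have := hground₂.sub_le (q := (x, y, 0)) (a := e1) (b := e2)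
        (by simp [pmD, Dset]) (by simp [pmD, Dset]) (by simp [pmD, Dset])
        (by simp [e1, e2]) rfl
      simp only [ground, Tet, e1, e2, Set.mem_ofPred_eq, Prod.mk_add_mk, add_zero,
        and_true] at this
      have := this (by omega) (by omega) (by omega) (by omega)
      push_cast
      linarith
    · intro x
      constructor
      · intro z hz
        have := hfront₂.sub_le (q := (x, 0, z)) (a := e1) (b := e3)
          (by simp [pmD, Dset]) (by simp [pmD, Dset]) (by simp [pmD, Dset])
          (by simp [e1, e3]) rfl
        simp only [frontWall, Tet, e1, e3, Set.mem_ofPred_eq, Prod.mk_add_mk, add_zero,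
          and_true] at this
        have := this (by omega) (by omega) (by omega) (by omega)
        push_cast
        linarith
      · intro z hz
        have := hfront₁.sub_le (q := (x + 1, 0, z)) (a := e3) (b := e3 - e1)
          (by simp [pmD, Dset]) (by simp [pmD, Dset]) (by simp [pmD, Dset])
          (by simp [e1, e3]) (by simp)
        simp only [frontWall, Tet, e1, e3, Set.mem_ofPred_eq, Prod.mk_add_mk, Prod.mk_sub_mk,
          add_zero, sub_zero, zero_sub, add_neg_cancel, and_true, add_assoc, one_add_one_eq_two] at this
        have := this (by omega) (by omega) (by omega) (by omega)
        push_cast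
        linarith
  have hsub : ∀ y z : ℤ, 0 ≤ y → 0 ≤ z → y + z + 2 ≤ n →
      F (0, y, z) + F (0, y + 1, z + 1) ≤ F (0, y, z + 1) + F (0, y + 1, z) := by
    intro y z hy hz h
    lift y to ℕ using hy
    lift z to ℕ using hz
    exact_mod_cast (hint y).1 z (by omega)
  have hhor : ∀ y z : ℤ, 0 ≤ y → 0 ≤ z → y + z + 2 ≤ n →
      F (0, y + 1, z) + F (0, y, z + 2) ≤ F (0, y, z + 1) + F (0, y + 1, z + 1) := by
    intro y z hy hz h
    lift y to ℕ using hy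
    lift z to ℕ using hz
    exact_mod_cast (hint y).2 z (by omega)
  constructor
  · refine FaceR.of_sub_eq ?_
    rintro ⟨q1, q2, q3⟩ ⟨a1, a2, a3⟩ ⟨b1, b2, b3⟩ ha hb hd h1 h2 h3 h4
    simp [pmD, Dset, e1, e2, e3, shadowWall, Tet] at ha hb hd h1 h2 h3 h4 ⊢
    have hcase : (a2 = 0 ∧ a3 = 1 ∧ b2 = -1 ∧ b3 = 1) ∨
      (a2 = 1 ∧ a3 = -1 ∧ b2 = 0 ∧ b3 = -1) := by omega
    obtain ⟨rfl, rfl, rfl⟩ : q1 = 0 ∧ a1 = 0 ∧ b1 = 0 := by omega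
    rcases hcase with ⟨rfl, rfl, rfl, rfl⟩ | ⟨rfl, rfl, rfl, rfl⟩
    · have := hhor (q2 - 1) q3 (by omega) (by omega) (by omega)
      ring_nf at this ⊢
      linarith
    · have := hhor q2 (q3 - 2) (by omega) (by omega) (by omega)
      ring_nf at this ⊢
      linarith
  · refine FaceR.of_sub_eq ?_
    rintro ⟨q1, q2, q3⟩ ⟨a1, a2, a3⟩ ⟨b1, b2, b3⟩ ha hb hd h1 h2 h3 h4
    simp [pmD, Dset, e1, e2, e3, shadowWall, Tet] at ha hb hd h1 h2 h3 h4 ⊢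
    have hcase : (a2 = 1 ∧ a3 = 0 ∧ b2 = 0 ∧ b3 = 1) ∨
      (a2 = 0 ∧ a3 = -1 ∧ b2 = -1 ∧ b3 = 0) := by omega
    obtain ⟨rfl, rfl, rfl⟩ : q1 = 0 ∧ a1 = 0 ∧ b1 = 0 := by omega
    rcases hcase with ⟨rfl, rfl, rfl, rfl⟩ | ⟨rfl, rfl, rfl, rfl⟩
    · have := hsub q2 q3 (by omega) (by omega) (by omega)
      ring_nf at this ⊢
      linarith
    · have := hsub (q2 - 1) (q3 - 1) (by omega) (by omega) (by omega)
      ring_nf at this ⊢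
      linarith
end

section
/- Let n, m ∈ ℕ and let F : P_{n,m} → ℝ be a polarized function on the prism grid P_{n,m}. If the restriction of F to the ceiling (face z = m) and the restriction of F to the shadow wall (face x = 0) are discrete concave, then F is polarized discrete concave on P_{n,m}, and in particular the restrictions of F to the front wall (face y = 0) and to the ground (face z = 0) are discrete concave. -/
/-- The prism grid `P_{n,m} = Δ_n(OXY) × {0,…,m}`. -/
def Prism (n m : ℕ) : Set V3 :=
  {v | 0 ≤ v.1 ∧ 0 ≤ v.2.1 ∧ v.1 + v.2.1 ≤ (n : ℤ) ∧ 0 ≤ v.2.2 ∧ v.2.2 ≤ (m : ℤ)}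

/-- The ground `z = 0` of the prism. -/
def prismGround (n m : ℕ) : Set V3 := {v | v ∈ Prism n m ∧ v.2.2 = 0}

/-- The ceiling `z = m` of the prism. -/
def prismCeiling (n m : ℕ) : Set V3 := {v | v ∈ Prism n m ∧ v.2.2 = (m : ℤ)}

/-- The front wall `y = 0` of the prism. -/
def prismFront (n m : ℕ) : Set V3 := {v | v ∈ Prism n m ∧ v.2.1 = 0}

/-- The shadow wall `x = 0` of the prism. -/
def prismShadow (n m : ℕ) : Set V3 := {v | v ∈ Prism n m ∧ v.1 = 0}

/-- The slope face `x + y = n` of the prism. -/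
def prismSlope (n m : ℕ) : Set V3 := {v | v ∈ Prism n m ∧ v.1 + v.2.1 = (n : ℤ)}

/-- `F` is polarized on the prism: the octahedron recurrence holds for primitive octahedra in
the prism, and on the non-modular slope face the recurrence degenerates to separability. -/
def IsPolarizedPrism (n m : ℕ) (F : V3 → ℝ) : Prop :=
  IsPolarizedOn (Prism n m) F ∧
  ∀ q : V3, q ∈ prismSlope n m → q + (-1, 1, 0) ∈ prismSlope n m →
    q + (0, 0, 1) ∈ prismSlope n m → q + (-1, 1, 1) ∈ prismSlope n m →
    F q + F (q + (-1, 1, 1)) = F (q + (-1, 1, 0)) + F (q + (0, 0, 1))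


/-- The octahedron recurrence on the prism, in coordinates: `(x, y, z)` is the corner of the unit
cube that contains the octahedron. -/
def OctahedronRec (n m : ℤ) (G : ℤ → ℤ → ℤ → ℝ) : Prop :=
  ∀ x y z, 0 ≤ x → 0 ≤ y → x + y + 2 ≤ n → 0 ≤ z → z + 1 ≤ m →
    G (x + 1) y z + G x (y + 1) (z + 1) =
      max (G (x + 1) y (z + 1) + G x (y + 1) z) (G (x + 1) (y + 1) z + G x y (z + 1))

/-- Separability on the slope face of the prism, in coordinates. -/
def SlopeSeparable (n m : ℤ) (G : ℤ → ℤ → ℤ → ℝ) : Prop :=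
  ∀ x y z, 0 ≤ x → 0 ≤ y → x + y + 1 = n → 0 ≤ z → z + 1 ≤ m →
    G (x + 1) y z + G x (y + 1) (z + 1) = G x (y + 1) z + G (x + 1) y (z + 1)

section Propagation

variable {n m : ℤ} {G : ℤ → ℤ → ℤ → ℝ}

/-- Rhombi with a long diagonal ending at `(x, y, z + 2)`: concavity propagates from the
shadow wall. -/
theorem concave_of_apex_e3 (hoct : OctahedronRec n m G) (hslope : SlopeSeparable n m G)
    (hwall : ∀ y z, 0 ≤ y → y + 1 ≤ n → 0 ≤ z → z + 2 ≤ m →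
      G 0 (y + 1) z + G 0 y (z + 2) ≤ G 0 y (z + 1) + G 0 (y + 1) (z + 1))
    {x y z : ℤ} (hx : 0 ≤ x) (hy : 0 ≤ y) (hz : 0 ≤ z) (hzm : z + 2 ≤ m) :
    (x + y + 1 ≤ n →
      G x (y + 1) z + G x y (z + 2) ≤ G x y (z + 1) + G x (y + 1) (z + 1) ∧
      G (x + 1) y z + G x y (z + 2) ≤ G x y (z + 1) + G (x + 1) y (z + 1)) ∧
    (x + y + 2 ≤ n →
      G (x + 1) (y + 1) z + G x y (z + 2) ≤ G (x + 1) y (z + 1) + G x (y + 1) (z + 1)) := by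
  have step : ∀ x y, 0 ≤ x → 0 ≤ y → x + y + 2 ≤ n →
      G (x + 1) (y + 1) z + G x (y + 1) (z + 2) ≤
        G x (y + 1) (z + 1) + G (x + 1) (y + 1) (z + 1) →
      G (x + 1) (y + 1) z + G (x + 1) y (z + 2) ≤
        G (x + 1) y (z + 1) + G (x + 1) (y + 1) (z + 1) ∧
      G (x + 1) (y + 1) z + G x y (z + 2) ≤ G (x + 1) y (z + 1) + G x (y + 1) (z + 1) := by
    intro x y hx hy hn hC
    have h := hoct x y (z + 1) hx hy hn (by lia) (by lia)
    rw [show z + 1 + 1 = z + 2 by ring] at h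
    have h₁ := le_max_left (G (x + 1) y (z + 2) + G x (y + 1) (z + 1))
      (G (x + 1) (y + 1) (z + 1) + G x y (z + 2))
    have h₂ := le_max_right (G (x + 1) y (z + 2) + G x (y + 1) (z + 1))
      (G (x + 1) (y + 1) (z + 1) + G x y (z + 2))
    constructor <;> linarith
  have row : ∀ x, 0 ≤ x →
      (∀ y, 0 ≤ y → x + y + 1 ≤ n →
        G x (y + 1) z + G x y (z + 2) ≤ G x y (z + 1) + G x (y + 1) (z + 1)) →
      ∀ j : ℕ, ∀ y, 0 ≤ y → x + y + 1 + j = n →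
        G (x + 1) y z + G x y (z + 2) ≤ G x y (z + 1) + G (x + 1) y (z + 1) := by
    intro x hx hA j
    induction j with
    | zero =>
      intro y hy hn
      have h₁ := hslope x y z hx hy (by lia) hz (by lia)
      have h₂ := hA y hy (by lia)
      linarith
    | succ j ih =>
      intro y hy hn
      have h₁ := (step x y hx hy (by lia) (ih (y + 1) (by lia) (by lia))).2
      have h₂ := hA y hy (by lia)
      have h₃ := hoct x y z hx hy (by lia) hz (by lia)
      rcases max_choice (G (x + 1) y (z + 1) + G x (y + 1) z)
        (G (x + 1) (y + 1) z + G x y (z + 1)) with h | h <;> rw [h] at h₃ <;> linarith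
  have wall : ∀ x, 0 ≤ x → ∀ y, 0 ≤ y → x + y + 1 ≤ n →
      G x (y + 1) z + G x y (z + 2) ≤ G x y (z + 1) + G x (y + 1) (z + 1) := by
    intro x hx
    induction x, hx using Int.leInduction with
    | base => exact fun y hy hn ↦ hwall y z hy (by lia) hz hzm
    | succ x hx ih =>
      exact fun y hy hn ↦ (step x y hx hy (by lia)
        (row x hx ih (n - x - (y + 1) - 1).toNat (y + 1) (by lia) (by lia))).1
  exact ⟨fun hn ↦ ⟨wall x hx y hy hn,
      row x hx (wall x hx) (n - x - y - 1).toNat y hy (by lia)⟩,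
    fun hn ↦ (step x y hx hy hn
      (row x hx (wall x hx) (n - x - (y + 1) - 1).toNat (y + 1) (by lia) (by lia))).2⟩

/-- Rhombi with a long diagonal ending at `(x, y + 2, z)`: concavity propagates from the
ceiling and the shadow wall. -/
theorem concave_of_apex_e2 (hoct : OctahedronRec n m G) (hslope : SlopeSeparable n m G)
    (hwall : ∀ y z, 0 ≤ y → y + 2 ≤ n → 0 ≤ z → z + 1 ≤ m →
      G 0 y (z + 1) + G 0 (y + 2) z ≤ G 0 (y + 1) z + G 0 (y + 1) (z + 1))
    (hceil : ∀ x y, 0 ≤ x → 0 ≤ y → x + y + 2 ≤ n →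
      G (x + 1) y m + G x (y + 2) m ≤ G x (y + 1) m + G (x + 1) (y + 1) m)
    {x y z : ℤ} (hx : 0 ≤ x) (hy : 0 ≤ y) (hn : x + y + 2 ≤ n) (hz : 0 ≤ z) :
    (z ≤ m → G (x + 1) y z + G x (y + 2) z ≤ G x (y + 1) z + G (x + 1) (y + 1) z) ∧
    (z + 1 ≤ m →
      G x y (z + 1) + G x (y + 2) z ≤ G x (y + 1) z + G x (y + 1) (z + 1) ∧
      G (x + 1) y (z + 1) + G x (y + 2) z ≤ G (x + 1) (y + 1) z + G x (y + 1) (z + 1)) := by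
  have step : ∀ z, 0 ≤ z → z + 1 ≤ m →
      (∀ x y, 0 ≤ x → 0 ≤ y → x + y + 2 ≤ n →
        G (x + 1) y (z + 1) + G x (y + 2) (z + 1) ≤
          G x (y + 1) (z + 1) + G (x + 1) (y + 1) (z + 1)) →
      ∀ x y, 0 ≤ x → 0 ≤ y → x + y + 2 ≤ n →
        G x y (z + 1) + G x (y + 2) z ≤ G x (y + 1) z + G x (y + 1) (z + 1) ∧
        G (x + 1) y (z + 1) + G x (y + 2) z ≤ G (x + 1) (y + 1) z + G x (y + 1) (z + 1) := by
    intro z hz hzm hC x y hx hy hn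
    constructor
    · rcases hx.eq_or_lt with rfl | hx
      · exact hwall y z hy (by lia) hz hzm
      · obtain ⟨x, rfl⟩ : ∃ x', x = x' + 1 := ⟨x - 1, by ring⟩
        have h := hoct x (y + 1) z (by lia) (by lia) (by lia) hz hzm
        rw [show y + 1 + 1 = y + 2 by ring] at h
        have h₁ := le_max_right (G (x + 1) (y + 1) (z + 1) + G x (y + 2) z)
          (G (x + 1) (y + 2) z + G x (y + 1) (z + 1))
        have h₂ := hC x y (by lia) hy (by lia)
        linarith
    · have h₂ := hC x y hx hy hn
      rcases hn.eq_or_lt with hn | hn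
      · have h := hslope x (y + 1) z hx (by lia) (by lia) hz hzm
        rw [show y + 1 + 1 = y + 2 by ring] at h
        linarith
      · have h := hoct x (y + 1) z hx (by lia) (by lia) hz hzm
        rw [show y + 1 + 1 = y + 2 by ring] at h
        have h₁ := le_max_left (G (x + 1) (y + 1) (z + 1) + G x (y + 2) z)
          (G (x + 1) (y + 2) z + G x (y + 1) (z + 1))
        linarith
  have level : ∀ j : ℕ, ∀ z, 0 ≤ z → z + j = m → ∀ x y, 0 ≤ x → 0 ≤ y → x + y + 2 ≤ n →
      G (x + 1) y z + G x (y + 2) z ≤ G x (y + 1) z + G (x + 1) (y + 1) z := by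
    intro j
    induction j with
    | zero =>
      intro z hz hzm
      obtain rfl : z = m := by lia
      exact hceil
    | succ j ih =>
      intro z hz hzm x y hx hy hn
      obtain ⟨h₁, h₂⟩ := step z hz (by lia) (ih (z + 1) (by lia) (by lia)) x y hx hy hn
      have h₃ := hoct x y z hx hy hn hz (by lia)
      rcases max_choice (G (x + 1) y (z + 1) + G x (y + 1) z)
        (G (x + 1) (y + 1) z + G x y (z + 1)) with h | h <;> rw [h] at h₃ <;> linarith
  exact ⟨fun hzm ↦ level (m - z).toNat z hz (by lia) x y hx hy hn,
    fun hzm ↦ step z hz hzm (level (m - (z + 1)).toNat (z + 1) (by lia) (by lia)) x y hx hy hn⟩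

/-- Rhombi with a long diagonal ending at the corner `(x, y, z)`: concavity propagates from the
ceiling and the shadow wall. -/
theorem concave_of_apex_zero (hoct : OctahedronRec n m G) (hslope : SlopeSeparable n m G)
    (hwall : ∀ y z, 0 ≤ y → y + 1 ≤ n → 0 ≤ z → z + 1 ≤ m →
      G 0 (y + 1) (z + 1) + G 0 y z ≤ G 0 (y + 1) z + G 0 y (z + 1))
    (hceil : ∀ x y, 0 ≤ x → 0 ≤ y → x + y + 2 ≤ n →
      G (x + 1) (y + 1) m + G x y m ≤ G x (y + 1) m + G (x + 1) y m)
    {x y z : ℤ} (hx : 0 ≤ x) (hy : 0 ≤ y) (hz : 0 ≤ z) :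
    (x + y + 2 ≤ n → z ≤ m →
      G (x + 1) (y + 1) z + G x y z ≤ G x (y + 1) z + G (x + 1) y z) ∧
    (x + y + 1 ≤ n → z + 1 ≤ m →
      G (x + 1) y (z + 1) + G x y z ≤ G x y (z + 1) + G (x + 1) y z ∧
      G x (y + 1) (z + 1) + G x y z ≤ G x (y + 1) z + G x y (z + 1)) := by
  have horiz : ∀ x y z, 0 ≤ x → 0 ≤ y → x + y + 2 ≤ n → 0 ≤ z → z ≤ m →
      (z + 1 ≤ m → G x (y + 1) (z + 1) + G x y z ≤ G x (y + 1) z + G x y (z + 1)) →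
      G (x + 1) (y + 1) z + G x y z ≤ G x (y + 1) z + G (x + 1) y z := by
    intro x y z hx hy hn hz hzm hC
    rcases hzm.eq_or_lt with rfl | hzm
    · exact hceil x y hx hy hn
    · have h₁ := hC hzm
      have h₂ := hoct x y z hx hy hn hz hzm
      have h₃ := le_max_right (G (x + 1) y (z + 1) + G x (y + 1) z)
        (G (x + 1) (y + 1) z + G x y (z + 1))
      linarith
  have front : ∀ x y z, 0 ≤ x → 0 ≤ y → x + y + 1 ≤ n → 0 ≤ z → z + 1 ≤ m →
      G x (y + 1) (z + 1) + G x y z ≤ G x (y + 1) z + G x y (z + 1) →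
      G (x + 1) y (z + 1) + G x y z ≤ G x y (z + 1) + G (x + 1) y z := by
    intro x y z hx hy hn hz hzm hC
    rcases hn.eq_or_lt with hn | hn
    · have := hslope x y z hx hy hn hz hzm
      linarith
    · have h₂ := hoct x y z hx hy (by lia) hz hzm
      have h₃ := le_max_left (G (x + 1) y (z + 1) + G x (y + 1) z)
        (G (x + 1) (y + 1) z + G x y (z + 1))
      linarith
  have wall : ∀ x, 0 ≤ x → ∀ y z, 0 ≤ y → x + y + 1 ≤ n → 0 ≤ z → z + 1 ≤ m →
      G x (y + 1) (z + 1) + G x y z ≤ G x (y + 1) z + G x y (z + 1) := by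
    intro x hx
    induction x, hx using Int.leInduction with
    | base => exact fun y z hy hn hz hzm ↦ hwall y z hy (by lia) hz hzm
    | succ x hx ih =>
      intro y z hy hn hz hzm
      have h₁ := horiz x y (z + 1) hx hy (by lia) (by lia) hzm
        (ih y (z + 1) hy (by lia) (by lia))
      have h₂ := front x (y + 1) z hx (by lia) (by lia) hz hzm
        (ih (y + 1) z (by lia) (by lia) hz hzm)
      have h₃ := hoct x y z hx hy (by lia) hz hzm
      rcases max_choice (G (x + 1) y (z + 1) + G x (y + 1) z)
        (G (x + 1) (y + 1) z + G x y (z + 1)) with h | h <;> rw [h] at h₃ <;> linarith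
  exact ⟨fun hn hzm ↦ horiz x y z hx hy hn hz hzm (wall x hx y z hy (by lia) hz),
    fun hn hzm ↦ ⟨front x y z hx hy hn hz hzm (wall x hx y z hy hn hz hzm),
      wall x hx y z hy hn hz hzm⟩⟩

/-- Rhombi with a long diagonal ending at `(x + 2, y, z)`: concavity propagates from the
ceiling. -/
theorem concave_of_apex_e1 (hoct : OctahedronRec n m G) (hslope : SlopeSeparable n m G)
    (hceil : ∀ x y, 0 ≤ x → 0 ≤ y → x + y + 2 ≤ n →
      G x (y + 1) m + G (x + 2) y m ≤ G (x + 1) (y + 1) m + G (x + 1) y m)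
    {x y z : ℤ} (hx : 0 ≤ x) (hy : 0 ≤ y) (hn : x + y + 2 ≤ n) (hz : 0 ≤ z) :
    (z ≤ m → G x (y + 1) z + G (x + 2) y z ≤ G (x + 1) (y + 1) z + G (x + 1) y z) ∧
    (z + 1 ≤ m →
      G x y (z + 1) + G (x + 2) y z ≤ G (x + 1) y (z + 1) + G (x + 1) y z ∧
      G x (y + 1) (z + 1) + G (x + 2) y z ≤ G (x + 1) (y + 1) z + G (x + 1) y (z + 1)) := by
  have split : ∀ x y z, 0 ≤ x → 0 ≤ y → x + y + 2 ≤ n → 0 ≤ z → z + 1 ≤ m →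
      G x (y + 1) (z + 1) + G (x + 2) y z ≤ G (x + 1) (y + 1) z + G (x + 1) y (z + 1) →
      G x (y + 1) z + G (x + 2) y z ≤ G (x + 1) (y + 1) z + G (x + 1) y z ∧
      G x y (z + 1) + G (x + 2) y z ≤ G (x + 1) y (z + 1) + G (x + 1) y z := by
    intro x y z hx hy hn hz hzm hC
    have h := hoct x y z hx hy hn hz hzm
    have h₁ := le_max_left (G (x + 1) y (z + 1) + G x (y + 1) z)
      (G (x + 1) (y + 1) z + G x y (z + 1))
    have h₂ := le_max_right (G (x + 1) y (z + 1) + G x (y + 1) z)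
      (G (x + 1) (y + 1) z + G x y (z + 1))
    constructor <;> linarith
  have row : ∀ z, 0 ≤ z → z + 1 ≤ m →
      (∀ x y, 0 ≤ x → 0 ≤ y → x + y + 2 ≤ n →
        G x (y + 1) (z + 1) + G (x + 2) y (z + 1) ≤
          G (x + 1) (y + 1) (z + 1) + G (x + 1) y (z + 1)) →
      ∀ j : ℕ, ∀ x y, 0 ≤ x → 0 ≤ y → x + y + 2 + j = n →
        G x (y + 1) (z + 1) + G (x + 2) y z ≤
          G (x + 1) (y + 1) z + G (x + 1) y (z + 1) := by
    intro z hz hzm hA j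
    induction j with
    | zero =>
      intro x y hx hy hn
      have h₁ := hslope (x + 1) y z (by lia) hy (by lia) hz hzm
      have h₂ := hA x y hx hy (by lia)
      rw [show x + 1 + 1 = x + 2 by ring] at h₁
      linarith
    | succ j ih =>
      intro x y hx hy hn
      have h₁ := hA x y hx hy (by lia)
      have h₂ := (split x (y + 1) z hx (by lia) (by lia) hz hzm
        (ih x (y + 1) hx (by lia) (by lia))).2
      have h₃ := hoct (x + 1) y z (by lia) hy (by lia) hz hzm
      rw [show x + 1 + 1 = x + 2 by ring] at h₃
      rcases max_choice (G (x + 2) y (z + 1) + G (x + 1) (y + 1) z)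
        (G (x + 2) (y + 1) z + G (x + 1) y (z + 1)) with h | h <;> rw [h] at h₃ <;> linarith
  have level : ∀ j : ℕ, ∀ z, 0 ≤ z → z + j = m → ∀ x y, 0 ≤ x → 0 ≤ y → x + y + 2 ≤ n →
      G x (y + 1) z + G (x + 2) y z ≤ G (x + 1) (y + 1) z + G (x + 1) y z := by
    intro j
    induction j with
    | zero =>
      intro z hz hzm
      obtain rfl : z = m := by lia
      exact hceil
    | succ j ih =>
      intro z hz hzm x y hx hy hn
      exact (split x y z hx hy hn hz (by lia) (row z hz (by lia)
        (ih (z + 1) (by lia) (by lia)) (n - x - y - 2).toNat x y hx hy (by lia))).1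
  refine ⟨fun hzm ↦ level (m - z).toNat z hz (by lia) x y hx hy hn, fun hzm ↦ ?_⟩
  have hC := row z hz hzm (level (m - (z + 1)).toNat (z + 1) (by lia) (by lia))
    (n - x - y - 2).toNat x y hx hy (by lia)
  exact ⟨(split x y z hx hy hn hz hzm hC).2, hC⟩

end Propagation

/-- The rhombus inequalities on `S` for the rhombi with sides `a`, `b` and short diagonal
`a + b`. -/
def ConcaveAlong (S : Set V3) (F : V3 → ℝ) (a b : V3) : Prop :=
  ∀ q, q ∈ S → q + a ∈ S → q + b ∈ S → q + a + b ∈ S →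
    F (q + a) + F (q + b) ≤ F q + F (q + a + b)

theorem ConcaveAlong.swap {S : Set V3} {F : V3 → ℝ} {a b : V3} (h : ConcaveAlong S F a b) :
    ConcaveAlong S F b a := by
  intro q hq hb ha hab
  rw [add_right_comm q b a] at hab ⊢
  linarith [h q hq ha hb hab]

theorem ConcaveAlong.neg {S : Set V3} {F : V3 → ℝ} {a b : V3} (h : ConcaveAlong S F a b) :
    ConcaveAlong S F (-a) (-b) := by
  intro q hq ha hb hab
  have e₁ : q + -a + -b + a = q + -b := by abel
  have e₂ : q + -a + -b + b = q + -a := by abel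
  have e₃ : q + -a + -b + a + b = q := by abel
  have := h (q + -a + -b) hab (by rwa [e₁]) (by rwa [e₂]) (by rwa [e₃])
  rw [e₃, e₁, e₂] at this
  linarith

theorem concaveAlong_iff_translate {S : Set V3} {F : V3 → ℝ} {a b : V3} (s : V3) :
    ConcaveAlong S F a b ↔ ∀ x y z, (x, y, z) + s ∈ S → (x, y, z) + s + a ∈ S →
      (x, y, z) + s + b ∈ S → (x, y, z) + s + a + b ∈ S →
      F ((x, y, z) + s + a) + F ((x, y, z) + s + b) ≤
        F ((x, y, z) + s) + F ((x, y, z) + s + a + b) :=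
  ⟨fun h _ _ _ ↦ h _, fun h q ↦ by
    simpa only [Prod.mk.eta, sub_add_cancel] using h (q - s).1 (q - s).2.1 (q - s).2.2⟩

theorem discreteConcaveOn_of_concaveAlong {S : Set V3} {F : V3 → ℝ}
    (h : ∀ a b, a ∈ pmD → b ∈ pmD → a + b ∈ pmD → ConcaveAlong S F a b) :
    DiscreteConcaveOn S F := by
  intro q a b hab hq ha hb hs
  refine ⟨fun hd ↦ h a b hab.1 hab.2.1 hd q hq ha hb hs, fun hd ↦ ?_⟩
  have neg_mem : ∀ v ∈ pmD, -v ∈ pmD := fun v hv ↦ hv.symm.imp id (by simp)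
  have e₁ : q + a + -a = q := by abel
  have e₂ : q + a + -a + b = q + b := by abel
  have := h (-a) b (neg_mem a hab.1) hab.2.1
    (by simpa [sub_eq_add_neg, add_comm] using neg_mem _ hd) (q + a) ha (by rwa [e₁]) hs
    (by rwa [e₂])
  rwa [e₂, e₁] at this

/-- The roots `±D` as an explicit list. -/
def rootList : List V3 :=
  [(1, 0, 0), (0, 1, 0), (0, 0, 1), (1, -1, 0), (1, 0, -1), (0, 1, -1),
    (-1, 0, 0), (0, -1, 0), (0, 0, -1), (-1, 1, 0), (-1, 0, 1), (0, -1, 1)]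

theorem mem_pmD_iff_s6 {v : V3} : v ∈ pmD ↔ v ∈ rootList := by
  obtain ⟨x, y, z⟩ := v
  simp only [pmD, Dset, e1, e2, e3, rootList, Set.mem_ofPred_eq, Set.mem_insert_iff,
    Set.mem_singleton_iff, List.mem_cons, List.not_mem_nil, Prod.mk_sub_mk, Prod.neg_mk,
    Prod.mk.injEq, neg_eq_iff_eq_neg, or_assoc]
  norm_num

/-- Representatives, up to swapping and negating, of the pairs of roots whose sum is a root. -/
def rhombusList : List (V3 × V3) :=
  [((0, 1, -1), (0, 0, 1)), ((0, 1, -1), (-1, 0, 1)), ((1, 0, -1), (0, 0, 1)),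
    ((0, -1, 1), (0, 1, 0)), ((0, -1, 1), (-1, 1, 0)), ((1, -1, 0), (0, 1, 0)),
    ((1, 0, 0), (0, -1, 0)), ((1, 0, 0), (0, 0, -1)), ((0, 0, 1), (0, -1, 0)),
    ((-1, 0, 0), (1, -1, 0)), ((-1, 0, 0), (1, 0, -1)), ((-1, 0, 1), (1, -1, 0))]

theorem mem_rhombusList_of_roots : ∀ a ∈ rootList, ∀ b ∈ rootList, a + b ∈ rootList →
    (a, b) ∈ rhombusList ∨ (b, a) ∈ rhombusList ∨
      (-a, -b) ∈ rhombusList ∨ (-b, -a) ∈ rhombusList := by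
  set_option synthInstance.maxSize 1000 in
  decide

theorem discreteConcaveOn_of_rhombusList {S : Set V3} {F : V3 → ℝ}
    (h : ∀ r ∈ rhombusList, ConcaveAlong S F r.1 r.2) : DiscreteConcaveOn S F := by
  refine discreteConcaveOn_of_concaveAlong fun a b ha hb hab ↦ ?_
  rw [mem_pmD_iff_s6] at ha hb hab
  rcases mem_rhombusList_of_roots a ha b hb hab with hr | hr | hr | hr
  · exact h _ hr
  · exact (h _ hr).swap
  · simpa using (h _ hr).neg
  · simpa using (h _ hr).neg.swap

theorem DiscreteConcaveOn.concaveAlong {S : Set V3} {F : V3 → ℝ} (h : DiscreteConcaveOn S F)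
    {a b : V3} (ha : a ∈ rootList) (hb : b ∈ rootList) (hab : a + b ∈ rootList)
    (hne : a ≠ b ∧ a ≠ -b) : ConcaveAlong S F a b := by
  rw [← mem_pmD_iff_s6] at ha hb hab
  exact fun q hq hqa hqb hs ↦
    (h q a b ⟨ha, hb, hne.1, hne.2, Or.inl hab⟩ hq hqa hqb hs).1 hab

theorem DiscreteConcaveOn.mono {S T : Set V3} {F : V3 → ℝ} (h : DiscreteConcaveOn T F)
    (hST : S ⊆ T) : DiscreteConcaveOn S F :=
  fun q a b hab hq ha hb hs ↦ h q a b hab (hST hq) (hST ha) (hST hb) (hST hs)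

theorem IsPolarizedPrism.octahedronRec {n m : ℕ} {F : V3 → ℝ} (h : IsPolarizedPrism n m F) :
    OctahedronRec n m fun x y z ↦ F (x, y, z) := by
  intro x y z hx hy hn hz hm
  have := h.1 (x + 1, y, z)
  simp only [Prism, Set.mem_ofPred_eq, Prod.mk_add_mk, add_zero, add_neg_cancel_right] at this
  exact this (by lia) (by lia) (by lia) (by lia) (by lia) (by lia)

theorem IsPolarizedPrism.slopeSeparable {n m : ℕ} {F : V3 → ℝ} (h : IsPolarizedPrism n m F) :
    SlopeSeparable n m fun x y z ↦ F (x, y, z) := by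
  intro x y z hx hy hn hz hm
  have := h.2 (x + 1, y, z)
  simp only [prismSlope, Prism, Set.mem_ofPred_eq, Prod.mk_add_mk, add_zero,
    add_neg_cancel_right] at this
  exact this (by lia) (by lia) (by lia) (by lia)

theorem IsPolarizedPrism.concaveAlong_apex_e3 {n m : ℕ} {F : V3 → ℝ}
    (hpol : IsPolarizedPrism n m F)
    (hshadow : DiscreteConcaveOn (prismShadow n m) F) :
    ConcaveAlong (Prism n m) F (0, 1, -1) (0, 0, 1) ∧
    ConcaveAlong (Prism n m) F (0, 1, -1) (-1, 0, 1) ∧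
    ConcaveAlong (Prism n m) F (1, 0, -1) (0, 0, 1) := by
  have hwall : ∀ y z : ℤ, 0 ≤ y → y + 1 ≤ n → 0 ≤ z → z + 2 ≤ m →
      F (0, y + 1, z) + F (0, y, z + 2) ≤ F (0, y, z + 1) + F (0, y + 1, z + 1) := by
    intro y z hy hn hz hm
    have := (concaveAlong_iff_translate (0, 0, 1)).1 (hshadow.concaveAlong (a := (0, 1, -1))
      (b := (0, 0, 1)) (by decide) (by decide) (by decide) (by decide)) 0 y z
    simp only [prismShadow, Prism, Set.mem_ofPred_eq, Prod.mk_add_mk, add_assoc, add_zero,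
      Int.reduceAdd, Int.reduceNeg] at this
    exact this (by lia) (by lia) (by lia) (by lia)
  have apex {x y z : ℤ} :=
    concave_of_apex_e3 (x := x) (y := y) (z := z) hpol.octahedronRec hpol.slopeSeparable hwall
  refine ⟨?_, ?_, ?_⟩
  · refine (concaveAlong_iff_translate (0, 0, 1)).2 fun x y z h₁ h₂ h₃ h₄ ↦ ?_
    simp only [Prism, Set.mem_ofPred_eq, Prod.mk_add_mk, add_assoc, add_zero,
      Int.reduceAdd, Int.reduceNeg] at h₁ h₂ h₃ h₄ ⊢
    exact ((apex (by lia) (by lia) (by lia) (by lia)).1 (by lia)).1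
  · refine (concaveAlong_iff_translate (1, 0, 1)).2 fun x y z h₁ h₂ h₃ h₄ ↦ ?_
    simp only [Prism, Set.mem_ofPred_eq, Prod.mk_add_mk, add_assoc, add_zero,
      Int.reduceAdd, Int.reduceNeg] at h₁ h₂ h₃ h₄ ⊢
    exact (apex (by lia) (by lia) (by lia) (by lia)).2 (by lia)
  · refine (concaveAlong_iff_translate (0, 0, 1)).2 fun x y z h₁ h₂ h₃ h₄ ↦ ?_
    simp only [Prism, Set.mem_ofPred_eq, Prod.mk_add_mk, add_assoc, add_zero,
      Int.reduceAdd, Int.reduceNeg] at h₁ h₂ h₃ h₄ ⊢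
    exact ((apex (by lia) (by lia) (by lia) (by lia)).1 (by lia)).2

theorem IsPolarizedPrism.concaveAlong_apex_e2 {n m : ℕ} {F : V3 → ℝ}
    (hpol : IsPolarizedPrism n m F)
    (hshadow : DiscreteConcaveOn (prismShadow n m) F)
    (hceiling : DiscreteConcaveOn (prismCeiling n m) F) :
    ConcaveAlong (Prism n m) F (0, -1, 1) (0, 1, 0) ∧
    ConcaveAlong (Prism n m) F (0, -1, 1) (-1, 1, 0) ∧
    ConcaveAlong (Prism n m) F (1, -1, 0) (0, 1, 0) := by
  have hwall : ∀ y z : ℤ, 0 ≤ y → y + 2 ≤ n → 0 ≤ z → z + 1 ≤ m →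
      F (0, y, z + 1) + F (0, y + 2, z) ≤ F (0, y + 1, z) + F (0, y + 1, z + 1) := by
    intro y z hy hn hz hm
    have := (concaveAlong_iff_translate (0, 1, 0)).1 (hshadow.concaveAlong (a := (0, -1, 1))
      (b := (0, 1, 0)) (by decide) (by decide) (by decide) (by decide)) 0 y z
    simp only [prismShadow, Prism, Set.mem_ofPred_eq, Prod.mk_add_mk, add_assoc, add_zero,
      Int.reduceAdd, Int.reduceNeg] at this
    exact this (by lia) (by lia) (by lia) (by lia)
  have hceil : ∀ x y : ℤ, 0 ≤ x → 0 ≤ y → x + y + 2 ≤ n →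
      F (x + 1, y, m) + F (x, y + 2, m) ≤ F (x, y + 1, m) + F (x + 1, y + 1, m) := by
    intro x y hx hy hn
    have := (concaveAlong_iff_translate (0, 1, 0)).1 (hceiling.concaveAlong (a := (1, -1, 0))
      (b := (0, 1, 0)) (by decide) (by decide) (by decide) (by decide)) x y m
    simp only [prismCeiling, Prism, Set.mem_ofPred_eq, Prod.mk_add_mk, add_assoc, add_zero,
      Int.reduceAdd, Int.reduceNeg] at this
    exact this (by lia) (by lia) (by lia) (by lia)
  have apex {x y z : ℤ} :=
    concave_of_apex_e2 (x := x) (y := y) (z := z) hpol.octahedronRec hpol.slopeSeparable hwall hceil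
  refine ⟨?_, ?_, ?_⟩
  · refine (concaveAlong_iff_translate (0, 1, 0)).2 fun x y z h₁ h₂ h₃ h₄ ↦ ?_
    simp only [Prism, Set.mem_ofPred_eq, Prod.mk_add_mk, add_assoc, add_zero,
      Int.reduceAdd, Int.reduceNeg] at h₁ h₂ h₃ h₄ ⊢
    exact ((apex (by lia) (by lia) (by lia) (by lia)).2 (by lia)).1
  · refine (concaveAlong_iff_translate (1, 1, 0)).2 fun x y z h₁ h₂ h₃ h₄ ↦ ?_
    simp only [Prism, Set.mem_ofPred_eq, Prod.mk_add_mk, add_assoc, add_zero,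
      Int.reduceAdd, Int.reduceNeg] at h₁ h₂ h₃ h₄ ⊢
    exact ((apex (by lia) (by lia) (by lia) (by lia)).2 (by lia)).2
  · refine (concaveAlong_iff_translate (0, 1, 0)).2 fun x y z h₁ h₂ h₃ h₄ ↦ ?_
    simp only [Prism, Set.mem_ofPred_eq, Prod.mk_add_mk, add_assoc, add_zero,
      Int.reduceAdd, Int.reduceNeg] at h₁ h₂ h₃ h₄ ⊢
    exact (apex (by lia) (by lia) (by lia) (by lia)).1 (by lia)

theorem IsPolarizedPrism.concaveAlong_apex_zero {n m : ℕ} {F : V3 → ℝ}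
    (hpol : IsPolarizedPrism n m F)
    (hshadow : DiscreteConcaveOn (prismShadow n m) F)
    (hceiling : DiscreteConcaveOn (prismCeiling n m) F) :
    ConcaveAlong (Prism n m) F (1, 0, 0) (0, -1, 0) ∧
    ConcaveAlong (Prism n m) F (1, 0, 0) (0, 0, -1) ∧
    ConcaveAlong (Prism n m) F (0, 0, 1) (0, -1, 0) := by
  have hwall : ∀ y z : ℤ, 0 ≤ y → y + 1 ≤ n → 0 ≤ z → z + 1 ≤ m →
      F (0, y + 1, z + 1) + F (0, y, z) ≤ F (0, y + 1, z) + F (0, y, z + 1) := by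
    intro y z hy hn hz hm
    have := (concaveAlong_iff_translate (0, 1, 0)).1 (hshadow.concaveAlong (a := (0, 0, 1))
      (b := (0, -1, 0)) (by decide) (by decide) (by decide) (by decide)) 0 y z
    simp only [prismShadow, Prism, Set.mem_ofPred_eq, Prod.mk_add_mk, add_assoc, add_zero,
      Int.reduceAdd, Int.reduceNeg] at this
    exact this (by lia) (by lia) (by lia) (by lia)
  have hceil : ∀ x y : ℤ, 0 ≤ x → 0 ≤ y → x + y + 2 ≤ n →
      F (x + 1, y + 1, m) + F (x, y, m) ≤ F (x, y + 1, m) + F (x + 1, y, m) := by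
    intro x y hx hy hn
    have := (concaveAlong_iff_translate (0, 1, 0)).1 (hceiling.concaveAlong (a := (1, 0, 0))
      (b := (0, -1, 0)) (by decide) (by decide) (by decide) (by decide)) x y m
    simp only [prismCeiling, Prism, Set.mem_ofPred_eq, Prod.mk_add_mk, add_assoc, add_zero,
      Int.reduceAdd, Int.reduceNeg] at this
    exact this (by lia) (by lia) (by lia) (by lia)
  have apex {x y z : ℤ} :=
    concave_of_apex_zero (x := x) (y := y) (z := z) hpol.octahedronRec hpol.slopeSeparable hwall hceil
  refine ⟨?_, ?_, ?_⟩
  · refine (concaveAlong_iff_translate (0, 1, 0)).2 fun x y z h₁ h₂ h₃ h₄ ↦ ?_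
    simp only [Prism, Set.mem_ofPred_eq, Prod.mk_add_mk, add_assoc, add_zero,
      Int.reduceAdd, Int.reduceNeg] at h₁ h₂ h₃ h₄ ⊢
    exact (apex (by lia) (by lia) (by lia)).1 (by lia) (by lia)
  · refine (concaveAlong_iff_translate (0, 0, 1)).2 fun x y z h₁ h₂ h₃ h₄ ↦ ?_
    simp only [Prism, Set.mem_ofPred_eq, Prod.mk_add_mk, add_assoc, add_zero,
      Int.reduceAdd, Int.reduceNeg] at h₁ h₂ h₃ h₄ ⊢
    exact ((apex (by lia) (by lia) (by lia)).2 (by lia) (by lia)).1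
  · refine (concaveAlong_iff_translate (0, 1, 0)).2 fun x y z h₁ h₂ h₃ h₄ ↦ ?_
    simp only [Prism, Set.mem_ofPred_eq, Prod.mk_add_mk, add_assoc, add_zero,
      Int.reduceAdd, Int.reduceNeg] at h₁ h₂ h₃ h₄ ⊢
    exact ((apex (by lia) (by lia) (by lia)).2 (by lia) (by lia)).2

theorem IsPolarizedPrism.concaveAlong_apex_e1 {n m : ℕ} {F : V3 → ℝ}
    (hpol : IsPolarizedPrism n m F)
    (hceiling : DiscreteConcaveOn (prismCeiling n m) F) :
    ConcaveAlong (Prism n m) F (-1, 0, 0) (1, -1, 0) ∧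
    ConcaveAlong (Prism n m) F (-1, 0, 0) (1, 0, -1) ∧
    ConcaveAlong (Prism n m) F (-1, 0, 1) (1, -1, 0) := by
  have hceil : ∀ x y : ℤ, 0 ≤ x → 0 ≤ y → x + y + 2 ≤ n →
      F (x, y + 1, m) + F (x + 2, y, m) ≤ F (x + 1, y + 1, m) + F (x + 1, y, m) := by
    intro x y hx hy hn
    have := (concaveAlong_iff_translate (1, 1, 0)).1 (hceiling.concaveAlong (a := (-1, 0, 0))
      (b := (1, -1, 0)) (by decide) (by decide) (by decide) (by decide)) x y m
    simp only [prismCeiling, Prism, Set.mem_ofPred_eq, Prod.mk_add_mk, add_assoc, add_zero,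
      Int.reduceAdd, Int.reduceNeg] at this
    exact this (by lia) (by lia) (by lia) (by lia)
  have apex {x y z : ℤ} :=
    concave_of_apex_e1 (x := x) (y := y) (z := z) hpol.octahedronRec hpol.slopeSeparable hceil
  refine ⟨?_, ?_, ?_⟩
  · refine (concaveAlong_iff_translate (1, 1, 0)).2 fun x y z h₁ h₂ h₃ h₄ ↦ ?_
    simp only [Prism, Set.mem_ofPred_eq, Prod.mk_add_mk, add_assoc, add_zero,
      Int.reduceAdd, Int.reduceNeg] at h₁ h₂ h₃ h₄ ⊢
    exact (apex (by lia) (by lia) (by lia) (by lia)).1 (by lia)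
  · refine (concaveAlong_iff_translate (1, 0, 1)).2 fun x y z h₁ h₂ h₃ h₄ ↦ ?_
    simp only [Prism, Set.mem_ofPred_eq, Prod.mk_add_mk, add_assoc, add_zero,
      Int.reduceAdd, Int.reduceNeg] at h₁ h₂ h₃ h₄ ⊢
    exact ((apex (by lia) (by lia) (by lia) (by lia)).2 (by lia)).1
  · refine (concaveAlong_iff_translate (1, 1, 0)).2 fun x y z h₁ h₂ h₃ h₄ ↦ ?_
    simp only [Prism, Set.mem_ofPred_eq, Prod.mk_add_mk, add_assoc, add_zero,
      Int.reduceAdd, Int.reduceNeg] at h₁ h₂ h₃ h₄ ⊢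
    exact ((apex (by lia) (by lia) (by lia) (by lia)).2 (by lia)).2

/-- if a polarized function on the prism `P_{n,m}` has discrete concave
restrictions to the ceiling and the shadow wall, then all rhombus inequalities in the prism
hold (so `F` is polarized discrete concave); in particular the restrictions to the front wall
and to the ground are discrete concave. -/
theorem prism_polarized_discrete_concave' (n m : ℕ) (F : V3 → ℝ)
    (hpol : IsPolarizedPrism n m F)
    (hceiling : DiscreteConcaveOn (prismCeiling n m) F)
    (hshadow : DiscreteConcaveOn (prismShadow n m) F) :
    DiscreteConcaveOn (Prism n m) F ∧
      DiscreteConcaveOn (prismFront n m) F ∧ DiscreteConcaveOn (prismGround n m) F := by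
  suffices h : DiscreteConcaveOn (Prism n m) F from
    ⟨h, h.mono fun _ hv ↦ hv.1, h.mono fun _ hv ↦ hv.1⟩
  obtain ⟨h₁, h₂, h₃⟩ := hpol.concaveAlong_apex_e3 hshadow
  obtain ⟨h₄, h₅, h₆⟩ := hpol.concaveAlong_apex_e2 hshadow hceiling
  obtain ⟨h₇, h₈, h₉⟩ := hpol.concaveAlong_apex_zero hshadow hceiling
  obtain ⟨h₁₀, h₁₁, h₁₂⟩ := hpol.concaveAlong_apex_e1 hceiling
  refine discreteConcaveOn_of_rhombusList fun r hr ↦ ?_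
  simp only [rhombusList, List.mem_cons, List.not_mem_nil, or_false] at hr
  rcases hr with rfl | rfl | rfl | rfl | rfl | rfl | rfl | rfl | rfl | rfl | rfl | rfl <;>
    assumption
end

section
/- Let n ∈ ℕ. For any functions g defined on the ground {(x,y,0) : x,y ≥ 0, x+y ≤ n} and h defined on the front wall {(x,0,z) : x,z ≥ 0, x+z ≤ n} of the tetrahedral grid Δ_n(OXYZ) with g(x,0,0) = h(x,0,0) for all 0 ≤ x ≤ n, there exists a unique polarized function F : Δ_n(OXYZ) → ℝ whose restriction to the ground is g and whose restriction to the front wall is h. -/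
open Classical

/-- The function solving the octahedron recurrence with data `g` on the plane `z = 0` and `h` on
the plane `y = 0`; its value at `(x, y, z)` is `octaRec g h y z x`. -/
noncomputable def octaRec (g h : V3 → ℝ) : ℕ → ℕ → ℤ → ℝ
  | y, 0, x => g (x, y, 0)
  | 0, z + 1, x => h (x, 0, z + 1)
  | y + 1, z + 1, x =>
    max (octaRec g h y (z + 1) (x + 1) + octaRec g h (y + 1) z x)
      (octaRec g h (y + 1) z (x + 1) + octaRec g h y (z + 1) x) - octaRec g h y z (x + 1)

theorem mem_Tet_iff {n : ℕ} {x y z : ℤ} :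
    (x, y, z) ∈ Tet n ↔ 0 ≤ x ∧ 0 ≤ y ∧ 0 ≤ z ∧ x + y + z ≤ (n : ℤ) := Iff.rfl

theorem isPolarizedOn_Tet_iff {n : ℕ} {F : V3 → ℝ} :
    IsPolarizedOn (Tet n) F ↔ ∀ (y z : ℕ) (x : ℤ), (x, (y + 1 : ℤ), (z + 1 : ℤ)) ∈ Tet n →
      F (x + 1, y, z) + F (x, y + 1, z + 1) =
        max (F (x + 1, y, z + 1) + F (x, y + 1, z)) (F (x + 1, y + 1, z) + F (x, y, z + 1)) := by
  constructor
  · intro hF y z x hm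
    have := hF (x + 1, y, z)
    simp only [Prod.mk_add_mk, add_zero, add_neg_cancel_right, mem_Tet_iff] at this hm
    apply this <;> omega
  · rintro hF ⟨x, y, z⟩ hp hq - - - -
    simp only [Prod.mk_add_mk, mem_Tet_iff] at hp hq
    obtain ⟨-, hy, hz, -⟩ := hp
    lift y to ℕ using hy
    lift z to ℕ using hz
    have := hF y z (x + -1) (mem_Tet_iff.2 hq)
    simpa only [Prod.mk_add_mk, add_zero, neg_add_cancel_right] using this

theorem IsPolarizedOn.eq_octaRec {n : ℕ} {F g h : V3 → ℝ} (hF : IsPolarizedOn (Tet n) F)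
    (hg : ∀ x y : ℤ, (x, y, 0) ∈ Tet n → F (x, y, 0) = g (x, y, 0))
    (hh : ∀ x z : ℤ, (x, 0, z) ∈ Tet n → F (x, 0, z) = h (x, 0, z))
    (y z : ℕ) (x : ℤ) (hm : (x, (y : ℤ), (z : ℤ)) ∈ Tet n) :
    F (x, y, z) = octaRec g h y z x := by
  induction y, z, x using octaRec.induct with
  | case1 y x => simpa [octaRec] using hg x y (by simpa using hm)
  | case2 z x => simpa [octaRec] using hh x (z + 1) (by simpa using hm)
  | case3 y z x ih₁ ih₂ ih₃ ih₄ ih₅ =>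
    have key := isPolarizedOn_Tet_iff.1 hF y z x (by simpa using hm)
    simp only [mem_Tet_iff, Nat.succ_eq_add_one, Nat.cast_add, Nat.cast_one] at *
    rw [octaRec, ← ih₁ (by omega), ← ih₂ (by omega), ← ih₃ (by omega), ← ih₄ (by omega),
      ← ih₅ (by omega), ← key]
    ring

theorem isPolarizedOn_octaRec (n : ℕ) (g h : V3 → ℝ) :
    IsPolarizedOn (Tet n) fun v => octaRec g h v.2.1.toNat v.2.2.toNat v.1 := by
  refine isPolarizedOn_Tet_iff.2 fun y z x _ => ?_
  simp only [Int.toNat_natCast, Int.toNat_natCast_add_one]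
  rw [octaRec.eq_3]
  ring

/-- Being polarized on `S` only depends on the values on `S`. -/
theorem IsPolarizedOn.congr {S : Set V3} {F G : V3 → ℝ} (hF : IsPolarizedOn S F)
    (hFG : ∀ v ∈ S, G v = F v) : IsPolarizedOn S G := by
  intro p h₁ h₂ h₃ h₄ h₅ h₆
  rw [hFG _ h₁, hFG _ h₂, hFG _ h₃, hFG _ h₄, hFG _ h₅, hFG _ h₆]
  exact hF p h₁ h₂ h₃ h₄ h₅ h₆

/-- given arbitrary initial data `g` on the ground and `h` on the front wall of
`Δ_n(OXYZ)` that agree on the common edge (the `x`-axis), there is a unique polarized function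
on `Δ_n(OXYZ)` restricting to `g` on the ground and to `h` on the front wall. -/
theorem tet_polarized_exists_unique (n : ℕ) (g h : V3 → ℝ)
    (hgh : ∀ x : ℤ, 0 ≤ x → x ≤ (n : ℤ) → g (x, 0, 0) = h (x, 0, 0)) :
    ∃! F : Tet n → ℝ,
      IsPolarizedOn (Tet n) (fun v => if hv : v ∈ Tet n then F ⟨v, hv⟩ else 0) ∧
      (∀ (v : V3) (hv : v ∈ Tet n), v.2.2 = 0 → F ⟨v, hv⟩ = g v) ∧
      (∀ (v : V3) (hv : v ∈ Tet n), v.2.1 = 0 → F ⟨v, hv⟩ = h v) := by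
  refine ⟨fun v => octaRec g h v.1.2.1.toNat v.1.2.2.toNat v.1.1, ⟨?_, ?_, ?_⟩, ?_⟩
  · exact (isPolarizedOn_octaRec n g h).congr fun v hv => dif_pos hv
  · rintro ⟨x, y, z⟩ ⟨-, hy, -, -⟩ (rfl : z = 0)
    lift y to ℕ using hy
    simp [octaRec]
  · rintro ⟨x, y, z⟩ ⟨hx, -, hz, hn⟩ (rfl : y = 0)
    lift z to ℕ using hz
    cases z with
    | zero => simpa [octaRec] using hgh x hx (by simpa using hn)
    | succ z => simp [octaRec]
  · rintro F ⟨hF, hg, hh⟩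
    funext ⟨⟨x, y, z⟩, hv⟩
    obtain ⟨-, hy, hz, -⟩ := mem_Tet_iff.1 hv
    lift y to ℕ using hy
    lift z to ℕ using hz
    have := hF.eq_octaRec (g := g) (h := h)
      (fun x y hm => by simpa only [dif_pos hm] using hg _ hm rfl)
      (fun x z hm => by simpa only [dif_pos hm] using hh _ hm rfl) y z x hv
    simpa only [dif_pos hv, Int.toNat_natCast] using this
end
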